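/- arXiv:2603.28782 — 2 statements merged into one kernel-verified Lean document; each statement's English description precedes it below -/
import Mathlib

section
/- Let β ∈ [0,1] and let f ∈ 𝒜_β have Taylor coefficients a_2, a_3. Then for every real μ: if μ < 0 then |a_3 − μ a_2²| ≤ ((8−12μ) + (8μ−8)β + 2β²)/((3−2β)(2−β)²); if 0 ≤ μ ≤ (2−β)²/(3−2β) then |a_3 − μ a_2²| ≤ 2/(3−2β); and if μ > (2−β)²/(3−2β) then |a_3 − μ a_2²| ≤ −((8−12μ) + (8μ−8)β + 2β²)/((3−2β)(2−β)²). All three inequalities are sharp. -/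
open Metric Filter Set

/-- The class `𝒜_β`: analytic `f(z) = z + ∑_{n≥2} aₙ zⁿ` on the unit disk with
`Re (β f(z)/z + (1-β) f'(z)) > 0`. -/
def IsAbeta (β : ℝ) (a : ℕ → ℂ) (f : ℂ → ℂ) : Prop :=
  a 0 = 0 ∧ a 1 = 1 ∧
  (∀ z ∈ Metric.ball (0 : ℂ) 1, HasSum (fun n => a n * z ^ n) (f z)) ∧
  ∀ z ∈ Metric.ball (0 : ℂ) 1, z ≠ 0 →
    0 < ((β : ℂ) * f z / z + (1 - (β : ℂ)) * deriv f z).re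

/-- A power series summing to `F` on the unit disk is the power series of `F` there. -/
theorem hasFPowerSeriesOnBall_ofScalars {c : ℕ → ℂ} {F : ℂ → ℂ}
    (h : ∀ z ∈ ball (0 : ℂ) 1, HasSum (fun n => c n * z ^ n) (F z)) :
    HasFPowerSeriesOnBall F (FormalMultilinearSeries.ofScalars ℂ c) 0 1 where
  r_le := by
    refine ENNReal.le_of_forall_nnreal_lt fun r hr => ?_
    have hr1 : (r : ℝ) < 1 := by exact_mod_cast hr
    refine FormalMultilinearSeries.le_radius_of_summable _ ?_
    have hs := (h (r : ℂ) (by simpa using hr1)).summable.norm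
    simpa [FormalMultilinearSeries.ofScalars_norm] using hs
  r_pos := one_pos
  hasSum := by
    intro y hy
    have hy' : y ∈ ball (0 : ℂ) 1 := by
      rwa [← Metric.eball_ofReal, ENNReal.ofReal_one]
    simpa [FormalMultilinearSeries.ofScalars_apply_eq, mul_comm] using h y hy'

theorem differentiableOn_of_hasSum {c : ℕ → ℂ} {F : ℂ → ℂ}
    (h : ∀ z ∈ ball (0 : ℂ) 1, HasSum (fun n => c n * z ^ n) (F z)) :
    DifferentiableOn ℂ F (ball 0 1) := by
  have := (hasFPowerSeriesOnBall_ofScalars h).differentiableOn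
  rwa [← ENNReal.ofReal_one, Metric.eball_ofReal] at this

theorem deriv_zero_of_hasSum {c : ℕ → ℂ} {F : ℂ → ℂ}
    (h : ∀ z ∈ ball (0 : ℂ) 1, HasSum (fun n => c n * z ^ n) (F z)) :
    deriv F 0 = c 1 := by
  simpa [FormalMultilinearSeries.ofScalars_apply_eq] using
    (hasFPowerSeriesOnBall_ofScalars h).hasFPowerSeriesAt.deriv

theorem hasSum_deriv_of_hasSum {c : ℕ → ℂ} {F : ℂ → ℂ}
    (h : ∀ z ∈ ball (0 : ℂ) 1, HasSum (fun n => c n * z ^ n) (F z))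
    {z : ℂ} (hz : z ∈ ball (0 : ℂ) 1) :
    HasSum (fun n : ℕ => (n + 1) * c (n + 1) * z ^ n) (deriv F z) := by
  have hcoeff (n : ℕ) : iteratedDeriv n F 0 = n.factorial * c n := by
    have hF := (hasFPowerSeriesOnBall_ofScalars h).hasFPowerSeriesAt
    have hT := hF.analyticAt.hasFPowerSeriesAt
    have := congrArg (fun p => p.coeff n) (hT.eq_formalMultilinearSeries hF)
    simp only [FormalMultilinearSeries.coeff_ofScalars] at this
    rw [← this]
    field_simp [Nat.factorial_ne_zero]
  have hd := (differentiableOn_of_hasSum h).deriv isOpen_ball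
  refine (Complex.hasSum_taylorSeries_on_ball hd hz).congr_fun ?_
  intro n
  rw [← iteratedDeriv_succ', hcoeff, Nat.factorial_succ]
  have : (n.factorial : ℂ) ≠ 0 := by exact_mod_cast n.factorial_ne_zero
  simp only [smul_eq_mul, sub_zero]
  push_cast
  field_simp

theorem hasSum_div_of_hasSum {c : ℕ → ℂ} {F : ℂ → ℂ} {z : ℂ}
    (h : HasSum (fun n => c n * z ^ n) (F z)) (hz : z ≠ 0) :
    HasSum (fun n => c (n + 1) * z ^ n) ((F z - c 0) / z) := by
  have h1 := ((hasSum_nat_add_iff' 1).mpr h).div_const z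
  simp only [Finset.sum_range_one, pow_zero, mul_one] at h1
  refine h1.congr_fun fun n => ?_
  field_simp
  ring

/-- The infinitesimal Schwarz–Pick inequality at the origin. -/
theorem norm_deriv_zero_le_one_sub_sq {g : ℂ → ℂ} (hd : DifferentiableOn ℂ g (ball 0 1))
    (hg : ∀ z ∈ ball (0 : ℂ) 1, ‖g z‖ ≤ 1) : ‖deriv g 0‖ ≤ 1 - ‖g 0‖ ^ 2 := by
  have h0 : (0 : ℂ) ∈ ball (0 : ℂ) 1 := by simp
  have hdg : HasDerivAt g (deriv g 0) 0 :=
    (hd.differentiableAt (isOpen_ball.mem_nhds h0)).hasDerivAt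
  have scaled (t : ℝ) (ht : t ∈ Ioo (0 : ℝ) 1) : t * ‖deriv g 0‖ ≤ 1 - t ^ 2 * ‖g 0‖ ^ 2 := by
    set w : ℂ := t * g 0 with hw
    have hb (z : ℂ) (hz : z ∈ ball (0 : ℂ) 1) : ‖t * g z‖ < 1 := by
      rw [norm_mul, Complex.norm_real, Real.norm_of_nonneg ht.1.le]
      nlinarith [hg z hz, ht.1, ht.2, norm_nonneg (g z)]
    have hne (u : ℂ) (hu : ‖u‖ < 1) : 1 - (starRingEnd ℂ) w * u ≠ 0 := by
      intro h
      have h1 : ‖(starRingEnd ℂ) w * u‖ = 1 := by rw [← sub_eq_zero.mp h, norm_one]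
      rw [norm_mul, RCLike.norm_conj] at h1
      nlinarith [hb 0 h0, norm_nonneg u, norm_nonneg w]
    have hle (u : ℂ) (hu : ‖u‖ < 1) : ‖(u - w) / (1 - (starRingEnd ℂ) w * u)‖ ≤ 1 := by
      rw [norm_div, div_le_one (norm_pos_iff.mpr (hne u hu))]
      refine le_of_sq_le_sq ?_ (norm_nonneg _)
      have hw1 : Complex.normSq w < 1 := by
        rw [Complex.normSq_eq_norm_sq]; nlinarith [hb 0 h0, norm_nonneg w]
      have hu1 : Complex.normSq u < 1 := by
        rw [Complex.normSq_eq_norm_sq]; nlinarith [norm_nonneg u]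
      rw [← Complex.normSq_eq_norm_sq, ← Complex.normSq_eq_norm_sq]
      simp only [Complex.normSq_apply, Complex.sub_re, Complex.sub_im, Complex.mul_re,
        Complex.mul_im, Complex.conj_re, Complex.conj_im, Complex.one_re, Complex.one_im] at *
      nlinarith [mul_nonneg (sub_nonneg.mpr hw1.le) (sub_nonneg.mpr hu1.le)]
    have hdiff : DifferentiableOn ℂ
        (fun z => (t * g z - w) / (1 - (starRingEnd ℂ) w * (t * g z))) (ball 0 1) :=
      ((hd.const_mul _).sub_const _).div (((hd.const_mul _).const_mul _).const_sub _)
        fun z hz => hne _ (hb z hz)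
    have hS := Complex.norm_deriv_le_one_of_mapsTo_ball hdiff
      (fun z hz => by simpa [← hw] using hle _ (hb z hz)) one_pos
    have hD : HasDerivAt (fun z => (t * g z - w) / (1 - (starRingEnd ℂ) w * (t * g z)))
        (t * deriv g 0 / (1 - (starRingEnd ℂ) w * w)) 0 := by
      have hn := hne w (hb 0 h0)
      refine HasDerivAt.congr_deriv (((hdg.const_mul (t : ℂ)).sub_const w).fun_div
        (((hdg.const_mul (t : ℂ)).const_mul ((starRingEnd ℂ) w)).const_sub 1)
        (hne _ (hb 0 h0))) ?_
      rw [← hw]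
      field_simp
      ring
    have hwt : ‖w‖ ^ 2 = t ^ 2 * ‖g 0‖ ^ 2 := by
      rw [hw, norm_mul, Complex.norm_real, mul_pow, Real.norm_eq_abs, sq_abs]
    have hwpos : 0 < 1 - ‖w‖ ^ 2 := by nlinarith [hb 0 h0, norm_nonneg w]
    have hden : ‖1 - (starRingEnd ℂ) w * w‖ = 1 - ‖w‖ ^ 2 := by
      rw [Complex.conj_mul', ← Complex.ofReal_pow, ← Complex.ofReal_one, ← Complex.ofReal_sub,
        Complex.norm_real, Real.norm_of_nonneg hwpos.le]
    rw [hD.deriv, norm_div, hden, div_le_one hwpos, norm_mul, Complex.norm_real,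
      Real.norm_of_nonneg ht.1.le, hwt] at hS
    exact hS
  have hmem : (1 : ℝ) ∈ closure (Ioo (0 : ℝ) 1) := by
    rw [closure_Ioo zero_ne_one]; simp
  have := ContinuousWithinAt.closure_le hmem
    (f := fun t : ℝ => t * ‖deriv g 0‖) (g := fun t : ℝ => 1 - t ^ 2 * ‖g 0‖ ^ 2)
    (by fun_prop) (by fun_prop) scaled
  simpa using this

/-- The second-coefficient inequality for functions with positive real part. -/
theorem norm_coeff_two_sub_le {c : ℕ → ℂ} {p : ℂ → ℂ} (hc : c 0 = 1)
    (h : ∀ z ∈ ball (0 : ℂ) 1, HasSum (fun n => c n * z ^ n) (p z))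
    (hp : ∀ z ∈ ball (0 : ℂ) 1, 0 < (p z).re) :
    ‖c 2 - c 1 ^ 2 / 2‖ ≤ 2 - ‖c 1‖ ^ 2 / 2 := by
  obtain ⟨q, hqs⟩ : ∃ q : ℂ → ℂ, ∀ z ∈ ball (0 : ℂ) 1,
      HasSum (fun n => c (n + 1) * z ^ n) (q z) := by
    refine ⟨fun z => ∑' n, c (n + 1) * z ^ n, fun z hz => Summable.hasSum ?_⟩
    rcases eq_or_ne z 0 with rfl | hz0
    · exact summable_of_ne_finset_zero (s := {0}) fun n hn => by
        simp [Finset.notMem_singleton.mp hn]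
    · exact (hasSum_div_of_hasSum (h z hz) hz0).summable
  have hpq (z : ℂ) (hz : z ∈ ball (0 : ℂ) 1) : p z = 1 + z * q z := by
    have h1 : HasSum (fun n => c (n + 1) * z ^ (n + 1)) (z * q z) :=
      ((hqs z hz).mul_left z).congr_fun fun n => by ring
    have h2 := (hasSum_nat_add_iff (f := fun n => c n * z ^ n) 1).mp h1
    rw [(h z hz).unique h2]
    simp [hc, add_comm]
  have hq0 : q 0 = c 1 :=
    (hqs 0 (by simp)).unique <| by
      simpa using hasSum_single (f := fun n => c (n + 1) * (0 : ℂ) ^ n) 0 fun n hn => by simp [hn]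
  have hqd := differentiableOn_of_hasSum hqs
  have hne (z : ℂ) (hz : z ∈ ball (0 : ℂ) 1) : 2 + z * q z ≠ 0 := by
    intro h0
    have := hp z hz
    rw [hpq z hz, show 1 + z * q z = -1 by linear_combination h0] at this
    norm_num at this
  have hzd : DifferentiableOn ℂ (fun z => z * q z) (ball 0 1) := differentiableOn_id.mul hqd
  have hwd : DifferentiableOn ℂ (fun z => z * q z / (2 + z * q z)) (ball 0 1) :=
    hzd.div (hzd.const_add 2) hne
  have hwb (z : ℂ) (hz : z ∈ ball (0 : ℂ) 1) : ‖z * q z / (2 + z * q z)‖ ≤ 1 := by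
    rw [norm_div, div_le_one (norm_pos_iff.mpr (hne z hz))]
    refine le_of_sq_le_sq ?_ (norm_nonneg _)
    have := hp z hz
    rw [hpq z hz] at this
    rw [← Complex.normSq_eq_norm_sq, ← Complex.normSq_eq_norm_sq]
    generalize z * q z = u at *
    simp [Complex.normSq_apply] at *
    nlinarith
  have hs (z : ℂ) (hz : z ∈ ball (0 : ℂ) 1) : ‖q z / (2 + z * q z)‖ ≤ 1 := by
    have hdslope := Complex.norm_dslope_le_div_of_mapsTo_ball hwd
      (fun z hz => by simpa using hwb z hz) hz
    rcases eq_or_ne z 0 with rfl | hz0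
    · have hder : HasDerivAt (fun z => z * q z / (2 + z * q z)) (q 0 / 2) 0 := by
        have h1 := (hasDerivAt_id' (0 : ℂ)).fun_mul
          (hqd.differentiableAt (isOpen_ball.mem_nhds hz)).hasDerivAt
        refine HasDerivAt.congr_deriv (h1.fun_div (h1.const_add 2) (by simp)) ?_
        simp
        ring
      rw [dslope_same, hder.deriv] at hdslope
      simpa using hdslope
    · rw [dslope_of_ne _ hz0, slope_def_field] at hdslope
      simpa only [zero_mul, zero_div, sub_zero, div_one, div_right_comm _ _ z,
        mul_div_cancel_left₀ _ hz0] using hdslope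
  have hder : HasDerivAt (fun z => q z / (2 + z * q z)) (c 2 / 2 - c 1 ^ 2 / 4) 0 := by
    have h0 : (0 : ℂ) ∈ ball (0 : ℂ) 1 := by simp
    have hq' := (hqd.differentiableAt (isOpen_ball.mem_nhds h0)).hasDerivAt
    rw [deriv_zero_of_hasSum hqs] at hq'
    have h1 := (hasDerivAt_id' (0 : ℂ)).fun_mul hq'
    refine HasDerivAt.congr_deriv (hq'.fun_div (h1.const_add 2) (by simp)) ?_
    simp [hq0]
    ring
  have key := norm_deriv_zero_le_one_sub_sq (hqd.fun_div (hzd.const_add 2) hne) hs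
  rw [hder.deriv] at key
  simp only [zero_mul, add_zero, hq0, norm_div, Complex.norm_ofNat] at key
  rw [show c 2 - c 1 ^ 2 / 2 = 2 * (c 2 / 2 - c 1 ^ 2 / 4) by ring, norm_mul, Complex.norm_ofNat]
  linarith

theorem hasSum_mul_div_add_mul_deriv {a : ℕ → ℂ} {f : ℂ → ℂ} (β : ℝ) (ha : a 0 = 0)
    (h : ∀ z ∈ ball (0 : ℂ) 1, HasSum (fun n => a n * z ^ n) (f z))
    {z : ℂ} (hz : z ∈ ball (0 : ℂ) 1) (hz0 : z ≠ 0) :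
    HasSum (fun n : ℕ => (1 + n * (1 - (β : ℂ))) * a (n + 1) * z ^ n)
      ((β : ℂ) * f z / z + (1 - (β : ℂ)) * deriv f z) := by
  have h1 := (hasSum_div_of_hasSum (h z hz) hz0).mul_left (β : ℂ)
  have h2 := (hasSum_deriv_of_hasSum h hz).mul_left (1 - (β : ℂ))
  rw [ha, sub_zero, ← mul_div_assoc] at h1
  exact (h1.add h2).congr_fun fun n => by ring

/-- The Fekete–Szegő inequality for the class `𝒜_β`, uniformly in the parameter. -/
theorem IsAbeta.norm_sub_le {β : ℝ} (hβ : β ≤ 1) {a : ℕ → ℂ} {f : ℂ → ℂ}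
    (hf : IsAbeta β a f) (μ : ℝ) :
    ‖a 3 - (μ : ℂ) * (a 2) ^ 2‖ ≤
      2 / (3 - 2 * β) * max 1 |1 - 2 * (μ * (3 - 2 * β) / (2 - β) ^ 2)| := by
  obtain ⟨ha0, ha1, hs, hre⟩ := hf
  set c : ℕ → ℂ := fun n => (1 + n * (1 - (β : ℂ))) * a (n + 1) with hc
  have hc0 : c 0 = 1 := by simp [hc, ha1]
  have h0 : ∑' n, c n * (0 : ℂ) ^ n = 1 := by
    rw [tsum_eq_single 0 fun n hn => by simp [hn]]
    simp [hc0]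
  have hp (z : ℂ) (hz : z ∈ ball (0 : ℂ) 1) :
      HasSum (fun n => c n * z ^ n) (∑' n, c n * z ^ n) := by
    refine Summable.hasSum ?_
    rcases eq_or_ne z 0 with rfl | hz0
    · exact summable_of_ne_finset_zero (s := {0}) fun n hn => by
        simp [Finset.notMem_singleton.mp hn]
    · exact (hasSum_mul_div_add_mul_deriv β ha0 hs hz hz0).summable
  have key := norm_coeff_two_sub_le hc0 hp fun z hz => by
    rcases eq_or_ne z 0 with rfl | hz0
    · simp [h0]
    · rw [(hasSum_mul_div_add_mul_deriv β ha0 hs hz hz0).tsum_eq]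
      exact hre z hz hz0
  set v : ℝ := μ * (3 - 2 * β) / (2 - β) ^ 2 with hv
  have h3 : 0 < 3 - 2 * β := by linarith
  have h2 : 0 < 2 - β := by linarith
  have h3c : (3 - 2 * β : ℂ) ≠ 0 := by exact_mod_cast h3.ne'
  have h2c : (2 - β : ℂ) ≠ 0 := by exact_mod_cast h2.ne'
  have e : a 3 - (μ : ℂ) * (a 2) ^ 2 =
      ((c 2 - c 1 ^ 2 / 2) + ((1 - 2 * v : ℝ) : ℂ) * (c 1 ^ 2 / 2)) / ((3 - 2 * β : ℝ) : ℂ) := by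
    simp only [hc, hv]
    push_cast
    rw [show (1 + 2 * (1 - (β : ℂ))) = 3 - 2 * β by ring,
      show (1 + 1 * (1 - (β : ℂ))) = 2 - β by ring]
    field_simp
    ring
  rw [e, norm_div, Complex.norm_real, Real.norm_of_nonneg h3.le, div_mul_eq_mul_div]
  gcongr
  refine (norm_add_le _ _).trans ?_
  rw [norm_mul, Complex.norm_real, Real.norm_eq_abs, norm_div, norm_pow, Complex.norm_ofNat]
  have hc1 : ‖c 1‖ ^ 2 / 2 ≤ 2 := by linarith [norm_nonneg (c 2 - c 1 ^ 2 / 2)]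
  have hm1 := le_max_left 1 |1 - 2 * v|
  have hm2 := le_max_right 1 |1 - 2 * v|
  nlinarith [sq_nonneg ‖c 1‖]

theorem re_inv_one_sub_gt_half {w : ℂ} (hw : ‖w‖ < 1) : 1 / 2 < ((1 - w)⁻¹).re := by
  have h1 : Complex.normSq w < 1 := by
    rw [Complex.normSq_eq_norm_sq]; nlinarith [norm_nonneg w]
  have hne : 1 - w ≠ 0 := by
    intro h
    rw [← sub_eq_zero.mp h, norm_one] at hw
    exact lt_irrefl _ hw
  rw [Complex.inv_re, div_lt_div_iff₀ two_pos (Complex.normSq_pos.mpr hne)]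
  simp only [Complex.normSq_apply, Complex.sub_re, Complex.sub_im, Complex.one_re,
    Complex.one_im] at *
  nlinarith

/-- The members of `𝒜_β` that come from `1/(1-z) + 1/(1-εz) - 1`; `ε = 1` and `ε = -1` are
extremal for the Fekete–Szegő functional. -/
theorem exists_isAbeta {β : ℝ} (hβ : β ≤ 1) {ε : ℂ} (hε : ‖ε‖ = 1) :
    ∃ b g, IsAbeta β b g ∧ b 2 = (1 + ε) / (2 - β) ∧ b 3 = (1 + ε ^ 2) / (3 - 2 * β) := by
  set c : ℕ → ℂ := fun n => 1 + ε ^ n - if n = 0 then 1 else 0 with hc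
  set b : ℕ → ℂ := fun n => if n = 0 then 0 else c (n - 1) / (1 + (n - 1 : ℕ) * (1 - (β : ℂ)))
    with hb
  have hden (n : ℕ) : 1 ≤ ‖(1 + n * (1 - (β : ℂ)))‖ := by
    have : (1 + n * (1 - (β : ℂ))) = ((1 + n * (1 - β) : ℝ) : ℂ) := by push_cast; rfl
    rw [this, Complex.norm_real, Real.norm_eq_abs]
    refine le_trans ?_ (le_abs_self _)
    nlinarith [(Nat.cast_nonneg n : (0 : ℝ) ≤ n)]
  have hcb (n : ℕ) : ‖c n‖ ≤ 3 := by
    refine (norm_sub_le _ _).trans ?_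
    have h1 : ‖1 + ε ^ n‖ ≤ 2 := (norm_add_le _ _).trans (by simp [hε]; norm_num)
    split_ifs <;> simp <;> linarith
  have hbb (n : ℕ) : ‖b n‖ ≤ 3 := by
    simp only [hb]
    split_ifs
    · simp
    · rw [norm_div]
      exact (div_le_self (norm_nonneg _) (hden _)).trans (hcb _)
  have hbs (z : ℂ) (hz : z ∈ ball (0 : ℂ) 1) :
      HasSum (fun n => b n * z ^ n) (∑' n, b n * z ^ n) := by
    refine Summable.hasSum (Summable.of_norm_bounded
      ((summable_geometric_of_lt_one (norm_nonneg z) (by simpa using hz)).mul_left 3) fun n => ?_)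
    rw [norm_mul, norm_pow]
    exact mul_le_mul_of_nonneg_right (hbb n) (by positivity)
  refine ⟨b, fun z => ∑' n, b n * z ^ n, ⟨by simp [hb], by simp [hb, hc], hbs, ?_⟩, ?_, ?_⟩
  · intro z hz hz0
    have hz1 : ‖z‖ < 1 := by simpa using hz
    have hεz : ‖ε * z‖ < 1 := by rwa [norm_mul, hε, one_mul]
    have h1 := hasSum_mul_div_add_mul_deriv β (by simp [hb]) hbs hz hz0
    have h2 : HasSum (fun n => c n * z ^ n) ((1 - z)⁻¹ + (1 - ε * z)⁻¹ - 1) := by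
      refine (((hasSum_geometric_of_norm_lt_one hz1).add
        (hasSum_geometric_of_norm_lt_one hεz)).sub (hasSum_ite_eq 0 1)).congr_fun fun n => ?_
      rcases eq_or_ne n 0 with rfl | hn
      · simp [hc]
      · simp [hc, hn]
        ring
    have h3 : (fun n : ℕ => (1 + n * (1 - (β : ℂ))) * b (n + 1) * z ^ n) =
        fun n => c n * z ^ n := by
      funext n
      have : (1 + n * (1 - (β : ℂ))) ≠ 0 := norm_pos_iff.mp (one_pos.trans_le (hden n))
      rw [show b (n + 1) = c n / (1 + n * (1 - (β : ℂ))) by simp [hb], mul_div_cancel₀ _ this]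
    rw [h3] at h1
    rw [h1.unique h2, Complex.sub_re, Complex.add_re, Complex.one_re]
    linarith [re_inv_one_sub_gt_half hz1, re_inv_one_sub_gt_half hεz]
  · simp [hb, hc]
    ring
  · simp [hb, hc]
    ring

theorem stmt4 (β : ℝ) (hβ : β ∈ Set.Icc (0 : ℝ) 1)
    (a : ℕ → ℂ) (f : ℂ → ℂ) (hf : IsAbeta β a f) (μ : ℝ) :
    (μ < 0 → ‖a 3 - (μ : ℂ) * (a 2) ^ 2‖
      ≤ ((8 - 12 * μ) + (8 * μ - 8) * β + 2 * β ^ 2) / ((3 - 2 * β) * (2 - β) ^ 2)) ∧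
    (0 ≤ μ → μ ≤ (2 - β) ^ 2 / (3 - 2 * β) →
      ‖a 3 - (μ : ℂ) * (a 2) ^ 2‖ ≤ 2 / (3 - 2 * β)) ∧
    ((2 - β) ^ 2 / (3 - 2 * β) < μ → ‖a 3 - (μ : ℂ) * (a 2) ^ 2‖
      ≤ -(((8 - 12 * μ) + (8 * μ - 8) * β + 2 * β ^ 2) / ((3 - 2 * β) * (2 - β) ^ 2))) ∧
    -- sharpness in each of the three regimes
    (μ < 0 → ∃ b g, IsAbeta β b g ∧ ‖b 3 - (μ : ℂ) * (b 2) ^ 2‖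
      = ((8 - 12 * μ) + (8 * μ - 8) * β + 2 * β ^ 2) / ((3 - 2 * β) * (2 - β) ^ 2)) ∧
    (0 ≤ μ → μ ≤ (2 - β) ^ 2 / (3 - 2 * β) →
      ∃ b g, IsAbeta β b g ∧ ‖b 3 - (μ : ℂ) * (b 2) ^ 2‖ = 2 / (3 - 2 * β)) ∧
    ((2 - β) ^ 2 / (3 - 2 * β) < μ → ∃ b g, IsAbeta β b g ∧ ‖b 3 - (μ : ℂ) * (b 2) ^ 2‖
      = -(((8 - 12 * μ) + (8 * μ - 8) * β + 2 * β ^ 2) / ((3 - 2 * β) * (2 - β) ^ 2))) := by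
  have h3 : 0 < 3 - 2 * β := by linarith [hβ.2]
  have h2 : 0 < 2 - β := by linarith [hβ.2]
  have h3c : (3 - 2 * β : ℂ) ≠ 0 := by exact_mod_cast h3.ne'
  have h2c : (2 - β : ℂ) ≠ 0 := by exact_mod_cast h2.ne'
  set v : ℝ := μ * (3 - 2 * β) / (2 - β) ^ 2 with hv
  have hv0 (h : μ < 0) : v < 0 := div_neg_of_neg_of_pos (mul_neg_of_neg_of_pos h h3) (by positivity)
  have hv1 (h : (2 - β) ^ 2 / (3 - 2 * β) < μ) : 1 < v := by
    rwa [hv, one_lt_div (by positivity), ← div_lt_iff₀ h3]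
  have hval : ((8 - 12 * μ) + (8 * μ - 8) * β + 2 * β ^ 2) / ((3 - 2 * β) * (2 - β) ^ 2) =
      2 / (3 - 2 * β) * (1 - 2 * v) := by
    rw [hv]
    field_simp
    ring
  have hle := hf.norm_sub_le hβ.2 μ
  rw [← hv] at hle
  have hextremal : ∃ b g, IsAbeta β b g ∧
      ‖b 3 - (μ : ℂ) * (b 2) ^ 2‖ = 2 / (3 - 2 * β) * |1 - 2 * v| := by
    obtain ⟨b, g, hb, hb2, hb3⟩ := exists_isAbeta hβ.2 (norm_one (α := ℂ))
    refine ⟨b, g, hb, ?_⟩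
    have e : b 3 - (μ : ℂ) * (b 2) ^ 2 = ((2 / (3 - 2 * β) * (1 - 2 * v) : ℝ) : ℂ) := by
      rw [hb2, hb3, hv]
      push_cast
      field_simp
      ring
    rw [e, Complex.norm_real, Real.norm_eq_abs, abs_mul, abs_of_pos (by positivity)]
  rw [hval]
  refine ⟨fun h => ?_, fun hl hr => ?_, fun h => ?_, fun h => ?_, fun _ _ => ?_, fun h => ?_⟩
  · have := hv0 h
    rwa [abs_of_pos (by linarith), max_eq_right (by linarith)] at hle
  · have h0 : 0 ≤ v := by positivity
    have h1 : v ≤ 1 := by rwa [hv, div_le_one (by positivity), ← le_div_iff₀ h3]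
    rwa [max_eq_left (abs_le.mpr ⟨by linarith, by linarith⟩), mul_one] at hle
  · have := hv1 h
    rwa [abs_of_neg (by linarith), max_eq_right (by linarith), mul_neg] at hle
  · have := hv0 h
    rwa [abs_of_pos (by linarith)] at hextremal
  · obtain ⟨b, g, hb, hb2, hb3⟩ := exists_isAbeta hβ.2 (ε := -1) (by simp)
    refine ⟨b, g, hb, ?_⟩
    have e : b 3 - (μ : ℂ) * (b 2) ^ 2 = ((2 / (3 - 2 * β) : ℝ) : ℂ) := by
      rw [hb2, hb3]
      push_cast
      ring
    rw [e, Complex.norm_real, Real.norm_of_nonneg (by positivity)]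
  · have := hv1 h
    rwa [abs_of_neg (by linarith), mul_neg] at hextremal
end

section
/- Let β ∈ [0,1] and let f ∈ 𝒜_β have Taylor coefficients a_2, a_3. Then |a_3 − a_2²| ≤ 2/(3−2β), and the inequality is sharp (equality holds for the function f_2 ∈ 𝒜_β determined by β·f_2(z)/z + (1−β)·f_2'(z) = (1+z²)/(1−z²)). -/
open Metric Filter Set

namespace PowerSeriesOnDisk

/-- A function given by a convergent power series on the unit disk has that power series in the
sense of `HasFPowerSeriesOnBall`. -/
theorem hasFPowerSeriesOnBall {a : ℕ → ℂ} {f : ℂ → ℂ}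
    (h : ∀ z ∈ ball (0 : ℂ) 1, HasSum (fun n => a n * z ^ n) (f z)) :
    HasFPowerSeriesOnBall f (FormalMultilinearSeries.ofScalars ℂ a) 0 1 := by
  refine ⟨?_, one_pos, fun {y} hy => ?_⟩
  · refine ENNReal.le_of_forall_nnreal_lt fun r hr => ?_
    have hr' : (r : ℝ) < 1 := by exact_mod_cast hr
    have hs := (h (r : ℂ) (by simpa [abs_of_nonneg r.coe_nonneg] using hr')).summable
    refine FormalMultilinearSeries.le_radius_of_tendsto _ (l := 0) ?_
    have ht := hs.tendsto_atTop_zero.norm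
    simpa using ht
  · have hy' : y ∈ ball (0 : ℂ) 1 := by
      simpa [enorm_eq_nnnorm, ← NNReal.coe_lt_coe] using hy
    simpa [FormalMultilinearSeries.ofScalars, mul_comm] using h y hy'

theorem differentiableOn {a : ℕ → ℂ} {f : ℂ → ℂ}
    (h : ∀ z ∈ ball (0 : ℂ) 1, HasSum (fun n => a n * z ^ n) (f z)) :
    DifferentiableOn ℂ f (ball 0 1) := by
  have := (hasFPowerSeriesOnBall h).differentiableOn
  rwa [← ENNReal.ofReal_one, eball_ofReal] at this

theorem iteratedDeriv_eq {a : ℕ → ℂ} {f : ℂ → ℂ}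
    (h : ∀ z ∈ ball (0 : ℂ) 1, HasSum (fun n => a n * z ^ n) (f z)) (n : ℕ) :
    iteratedDeriv n f 0 = n.factorial * a n := by
  have hf := hasFPowerSeriesOnBall h
  have key := hf.hasFPowerSeriesAt.eq_formalMultilinearSeries hf.analyticAt.hasFPowerSeriesAt
  have hn := congrArg (fun p => p.coeff n) key
  simp only [FormalMultilinearSeries.coeff_ofScalars] at hn
  rw [hn]
  field_simp [n.factorial_ne_zero]

theorem hasSum_deriv {a : ℕ → ℂ} {f : ℂ → ℂ}
    (h : ∀ z ∈ ball (0 : ℂ) 1, HasSum (fun n => a n * z ^ n) (f z))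
    {z : ℂ} (hz : z ∈ ball (0 : ℂ) 1) :
    HasSum (fun n : ℕ => (n + 1) * a (n + 1) * z ^ n) (deriv f z) := by
  have hd := (differentiableOn h).deriv isOpen_ball
  convert! Complex.hasSum_taylorSeries_on_ball hd hz using 2 with n
  rw [← iteratedDeriv_succ', iteratedDeriv_eq h, Nat.factorial_succ]
  have := Nat.cast_ne_zero (R := ℂ).2 n.factorial_ne_zero
  push_cast
  simp only [sub_zero, smul_eq_mul]
  field_simp

end PowerSeriesOnDisk

/-- The transform `β f(z)/z + (1-β) f'(z)` of a power series vanishing at the origin. -/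
theorem hasSum_abeta_transform {a : ℕ → ℂ} {f : ℂ → ℂ} (β : ℂ) (ha : a 0 = 0)
    (h : ∀ z ∈ ball (0 : ℂ) 1, HasSum (fun n => a n * z ^ n) (f z))
    {z : ℂ} (hz : z ∈ ball (0 : ℂ) 1) (hz0 : z ≠ 0) :
    HasSum (fun n : ℕ => (β + (1 - β) * (n + 1)) * a (n + 1) * z ^ n)
      (β * f z / z + (1 - β) * deriv f z) := by
  have h1 := (hasSum_nat_add_iff' 1).2 (h z hz)
  have h2 := ((h1.mul_left (β / z)).add
    ((PowerSeriesOnDisk.hasSum_deriv h hz).mul_left (1 - β)))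
  convert! h2 using 1
  · funext n
    field_simp
    ring
  · simp [ha]
    ring

namespace Caratheodory

theorem add_one_ne_zero {w : ℂ} (hw : 0 < w.re) : w + 1 ≠ 0 := fun h => by
  have := congrArg Complex.re h
  simp at this
  linarith

theorem norm_sub_one_div_add_one_lt {w : ℂ} (hw : 0 < w.re) : ‖(w - 1) / (w + 1)‖ < 1 := by
  rw [norm_div, div_lt_one (norm_pos_iff.2 (add_one_ne_zero hw)),
    ← sq_lt_sq₀ (norm_nonneg _) (norm_nonneg _),
    Complex.sq_norm, Complex.sq_norm, Complex.normSq_apply, Complex.normSq_apply]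
  simp
  nlinarith

/-- Cauchy's estimate for functions bounded by one on the unit disk. -/
theorem norm_iteratedDeriv_le {w : ℂ → ℂ} (hw : DifferentiableOn ℂ w (ball 0 1))
    (hb : ∀ z ∈ ball (0 : ℂ) 1, ‖w z‖ ≤ 1) (n : ℕ) :
    ‖iteratedDeriv n w 0‖ ≤ n.factorial := by
  have hlim : Tendsto (fun R : ℝ => n.factorial * 1 / R ^ n) (nhdsWithin 1 (Iio 1))
      (nhds (n.factorial * 1 / 1 ^ n)) :=
    tendsto_nhdsWithin_of_tendsto_nhds
      (ContinuousAt.tendsto (by fun_prop (disch := simp)))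
  rw [one_pow, div_one] at hlim
  rw [← mul_one (n.factorial : ℝ)]
  refine ge_of_tendsto hlim ?_
  filter_upwards [Ioo_mem_nhdsLT (zero_lt_one (α := ℝ))] with R hR
  have hsub : closedBall (0 : ℂ) R ⊆ ball 0 1 := closedBall_subset_ball hR.2
  exact Complex.norm_iteratedDeriv_le_of_forall_mem_sphere_norm_le n hR.1
    (hw.diffContOnCl_ball hsub) fun z hz => hb z (hsub (sphere_subset_closedBall hz))

theorem iteratedDeriv_two_mul {u v : ℂ → ℂ} {x : ℂ} (hu : AnalyticAt ℂ u x)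
    (hv : AnalyticAt ℂ v x) :
    iteratedDeriv 2 (u * v) x =
      u x * iteratedDeriv 2 v x + 2 * deriv u x * deriv v x + iteratedDeriv 2 u x * v x := by
  rw [iteratedDeriv_mul hu.contDiffAt hv.contDiffAt]
  simp [Finset.sum_range_succ]

/-- The second coefficient of a Carathéodory function with vanishing first coefficient. -/
theorem norm_iteratedDeriv_two_le_of_deriv_eq_zero {q : ℂ → ℂ}
    (hq : DifferentiableOn ℂ q (ball 0 1)) (h0 : q 0 = 1) (h1 : deriv q 0 = 0)
    (hre : ∀ z ∈ ball (0 : ℂ) 1, 0 < (q z).re) :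
    ‖iteratedDeriv 2 q 0‖ ≤ 4 := by
  have hball : ball (0 : ℂ) 1 ∈ nhds 0 := ball_mem_nhds 0 one_pos
  set w : ℂ → ℂ := fun z => (q z - 1) / (q z + 1) with hwdef
  have hw : DifferentiableOn ℂ w (ball 0 1) :=
    (hq.sub_const 1).div (hq.add_const 1) fun z hz => add_one_ne_zero (hre z hz)
  have hbound := norm_iteratedDeriv_le hw
    (fun z hz => (norm_sub_one_div_add_one_lt (hre z hz)).le) 2
  have hqa := hq.analyticAt hball
  have hmul : w * (fun z => q z + 1) =ᶠ[nhds 0] fun z => q z - 1 := by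
    filter_upwards [hball] with z hz
    exact div_mul_cancel₀ _ (add_one_ne_zero (hre z hz))
  have h := hmul.iteratedDeriv_eq 2
  have hqa1 : AnalyticAt ℂ (fun z => q z + 1) 0 := hqa.add analyticAt_const
  rw [iteratedDeriv_two_mul (hw.analyticAt hball) hqa1] at h
  have hw0 : w 0 = 0 := by simp [hwdef, h0]
  have hsub : iteratedDeriv 2 (fun z => q z - 1) 0 = iteratedDeriv 2 q 0 := by
    rw [iteratedDeriv_succ', iteratedDeriv_succ' (f := q)]
    simp
  rw [hsub, hw0, deriv_add_const, h1, h0] at h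
  have : iteratedDeriv 2 q 0 = 2 * iteratedDeriv 2 w 0 := by
    rw [← h]; ring
  rw [this, norm_mul]
  norm_num at hbound ⊢
  linarith

theorem norm_iteratedDeriv_two_le {p : ℂ → ℂ} (hp : DifferentiableOn ℂ p (ball 0 1))
    (h0 : p 0 = 1) (hre : ∀ z ∈ ball (0 : ℂ) 1, 0 < (p z).re) :
    ‖iteratedDeriv 2 p 0‖ ≤ 4 := by
  have hball : ball (0 : ℂ) 1 ∈ nhds 0 := ball_mem_nhds 0 one_pos
  have hneg : DifferentiableOn ℂ (fun z => p (-z)) (ball 0 1) :=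
    hp.comp (differentiableOn_neg _) fun z hz => by simpa using hz
  have hpa := hp.analyticAt hball
  have hna := hneg.analyticAt hball
  have hadd : ∀ n, iteratedDeriv n (fun z => 2⁻¹ * (p z + p (-z))) 0 =
      2⁻¹ * (iteratedDeriv n p 0 + (-1) ^ n * iteratedDeriv n p 0) := fun n => by
    rw [iteratedDeriv_const_mul_field, iteratedDeriv_fun_add hpa.contDiffAt hna.contDiffAt,
      iteratedDeriv_comp_neg]
    simp
  have h := norm_iteratedDeriv_two_le_of_deriv_eq_zero (q := fun z => 2⁻¹ * (p z + p (-z)))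
    ((hp.add hneg).const_mul _) (by simp [h0]; norm_num)
    (by simpa using hadd 1)
    (fun z hz => by
      have h1 := hre z hz
      have h2 := hre (-z) (by simpa using hz)
      have : (2⁻¹ * (p z + p (-z))).re = ((p z).re + (p (-z)).re) / 2 := by
        simp; ring
      rw [this]
      linarith)
  rw [hadd 2] at h
  convert! h using 2
  ring

theorem norm_two_mul_deriv_sq_sub_le {p : ℂ → ℂ} (hp : DifferentiableOn ℂ p (ball 0 1))
    (h0 : p 0 = 1) (hre : ∀ z ∈ ball (0 : ℂ) 1, 0 < (p z).re) :
    ‖2 * deriv p 0 ^ 2 - iteratedDeriv 2 p 0‖ ≤ 4 := by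
  have hball : ball (0 : ℂ) 1 ∈ nhds 0 := ball_mem_nhds 0 one_pos
  have hne : ∀ z ∈ ball (0 : ℂ) 1, p z ≠ 0 := fun z hz h => by
    simpa [h] using hre z hz
  have hi : DifferentiableOn ℂ p⁻¹ (ball 0 1) := hp.inv hne
  have h := norm_iteratedDeriv_two_le hi (by simp [h0]) fun z hz => by
    simp only [Pi.inv_apply, Complex.inv_re]
    exact div_pos (hre z hz) (Complex.normSq_pos.2 (hne z hz))
  have hpa := hp.analyticAt hball
  have hia := hi.analyticAt hball
  have hmul : p * p⁻¹ =ᶠ[nhds 0] fun _ => 1 := by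
    filter_upwards [hball] with z hz
    exact mul_inv_cancel₀ (hne z hz)
  have hd1 := hmul.deriv_eq
  have hd2 := hmul.iteratedDeriv_eq 2
  rw [iteratedDeriv_two_mul hpa hia] at hd2
  rw [deriv_mul hpa.differentiableAt hia.differentiableAt] at hd1
  simp only [Pi.inv_apply, h0, inv_one, deriv_const, mul_one, one_mul] at hd1
  simp [h0, iteratedDeriv_const] at hd2
  convert! h using 2
  linear_combination 2 * deriv p 0 * hd1 - hd2

/-- The Fekete–Szegő inequality for Carathéodory functions, with parameter in `[0, 1]`. -/
theorem norm_coeff_two_sub_le {c : ℕ → ℂ} {p : ℂ → ℂ}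
    (hp : ∀ z ∈ ball (0 : ℂ) 1, HasSum (fun n => c n * z ^ n) (p z)) (hc : c 0 = 1)
    (hre : ∀ z ∈ ball (0 : ℂ) 1, 0 < (p z).re) {μ : ℝ} (hμ : μ ∈ Icc (0 : ℝ) 1) :
    ‖c 2 - μ * c 1 ^ 2‖ ≤ 2 := by
  have hd := PowerSeriesOnDisk.differentiableOn hp
  have e := PowerSeriesOnDisk.iteratedDeriv_eq hp
  have e0 : p 0 = 1 := by simpa [hc] using e 0
  have e1 : deriv p 0 = c 1 := by simpa using e 1
  have e2 : iteratedDeriv 2 p 0 = 2 * c 2 := by simpa using e 2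
  have h1 := norm_iteratedDeriv_two_le hd e0 hre
  have h2 := norm_two_mul_deriv_sq_sub_le hd e0 hre
  rw [e2, norm_mul] at h1
  rw [e1, e2, ← mul_sub, norm_mul] at h2
  norm_num at h1 h2
  have hconv : c 2 - μ * c 1 ^ 2 =
      ((1 - μ : ℝ) : ℂ) * c 2 - (μ : ℂ) * (c 1 ^ 2 - c 2) := by
    push_cast; ring
  have hμ' : 0 ≤ 1 - μ := sub_nonneg.2 hμ.2
  calc ‖c 2 - μ * c 1 ^ 2‖ ≤ ‖((1 - μ : ℝ) : ℂ) * c 2‖ + ‖(μ : ℂ) * (c 1 ^ 2 - c 2)‖ := by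
        rw [hconv]; exact norm_sub_le _ _
    _ = (1 - μ) * ‖c 2‖ + μ * ‖c 1 ^ 2 - c 2‖ := by
        rw [norm_mul, norm_mul, Complex.norm_real, Complex.norm_real,
          Real.norm_of_nonneg hμ', Real.norm_of_nonneg hμ.1]
    _ ≤ 2 := by nlinarith [hμ.1]

end Caratheodory

theorem IsAbeta.norm_hankel_le {β : ℝ} (hβ : β ∈ Set.Icc (0 : ℝ) 1) {a : ℕ → ℂ} {f : ℂ → ℂ}
    (hf : IsAbeta β a f) : ‖a 3 - (a 2) ^ 2‖ ≤ 2 / (3 - 2 * β) := by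
  obtain ⟨ha0, ha1, hs, hre⟩ := hf
  set c : ℕ → ℂ := fun n => (β + (1 - β) * (n + 1)) * a (n + 1) with hc
  have hc0 : c 0 = 1 := by simp [hc, ha1]
  have hp : ∀ z ∈ ball (0 : ℂ) 1, HasSum (fun n => c n * z ^ n)
      (if z = 0 then 1 else (β : ℂ) * f z / z + (1 - (β : ℂ)) * deriv f z) := by
    intro z hz
    split_ifs with hz0
    · subst hz0
      have h0 := hasSum_single (f := fun n => c n * (0 : ℂ) ^ n) 0 fun n hn => by simp [hn]
      simpa [hc0] using h0
    · exact hasSum_abeta_transform β ha0 hs hz hz0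
  have h2 : 0 < 2 - β := by linarith [hβ.2]
  have h3 : 0 < 3 - 2 * β := by linarith [hβ.2]
  have key := Caratheodory.norm_coeff_two_sub_le (μ := (3 - 2 * β) / (2 - β) ^ 2) hp hc0
    (fun z hz => by
      split_ifs with hz0
      · simp
      · exact hre z hz hz0)
    ⟨by positivity, by rw [div_le_one (by positivity)]; nlinarith [sq_nonneg (1 - β)]⟩
  have h2' : (2 - β : ℂ) ≠ 0 := by exact_mod_cast h2.ne'
  have e : c 2 - ((3 - 2 * β) / (2 - β) ^ 2 : ℝ) * c 1 ^ 2 =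
      ((3 - 2 * β : ℝ) : ℂ) * (a 3 - a 2 ^ 2) := by
    simp only [hc]
    push_cast
    field_simp
    ring
  rw [e, norm_mul, Complex.norm_real, Real.norm_of_nonneg h3.le] at key
  rw [le_div_iff₀ h3]
  linarith

/-- The Taylor coefficients at the origin of `(1 + z ^ 2) / (1 - z ^ 2)`. -/
def evenKernelCoeff (n : ℕ) : ℂ := if n = 0 then 1 else if Even n then 2 else 0

theorem norm_evenKernelCoeff_le (n : ℕ) : ‖evenKernelCoeff n‖ ≤ 2 := by
  unfold evenKernelCoeff
  split_ifs <;> simp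

theorem norm_sq_lt_one {z : ℂ} (hz : z ∈ ball (0 : ℂ) 1) : ‖z ^ 2‖ < 1 := by
  rw [norm_pow]
  exact pow_lt_one₀ (norm_nonneg z) (by simpa using hz) two_ne_zero

theorem one_sub_sq_ne_zero {z : ℂ} (hz : z ∈ ball (0 : ℂ) 1) : 1 - z ^ 2 ≠ 0 := fun h => by
  have := norm_sq_lt_one hz
  rw [← sub_eq_zero.1 h] at this
  simp at this

theorem hasSum_evenKernelCoeff {z : ℂ} (hz : z ∈ ball (0 : ℂ) 1) :
    HasSum (fun n => evenKernelCoeff n * z ^ n) ((1 + z ^ 2) / (1 - z ^ 2)) := by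
  have he : HasSum (fun k : ℕ => evenKernelCoeff (2 * k) * z ^ (2 * k))
      ((1 + z ^ 2) / (1 - z ^ 2)) := by
    have hg := (hasSum_geometric_of_norm_lt_one (norm_sq_lt_one hz)).mul_left 2
    have h1 : HasSum (fun k : ℕ => if k = 0 then (-1 : ℂ) else 0) (-1) := hasSum_ite_eq 0 (-1)
    convert! hg.add h1 using 1
    · funext k
      rcases eq_or_ne k 0 with rfl | hk
      · norm_num [evenKernelCoeff]
      · simp [evenKernelCoeff, hk, pow_mul]
    · have := one_sub_sq_ne_zero hz
      field_simp
      ring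
  have ho : HasSum (fun k : ℕ => evenKernelCoeff (2 * k + 1) * z ^ (2 * k + 1)) 0 := by
    simp [evenKernelCoeff]
  rw [← add_zero ((1 + z ^ 2) / (1 - z ^ 2))]
  exact HasSum.even_add_odd (f := fun n => evenKernelCoeff n * z ^ n) he ho

theorem re_one_add_sq_div_one_sub_sq_pos {z : ℂ} (hz : z ∈ ball (0 : ℂ) 1) :
    0 < ((1 + z ^ 2) / (1 - z ^ 2)).re := by
  rw [Complex.div_re, ← add_div]
  refine div_pos ?_ (Complex.normSq_pos.2 (one_sub_sq_ne_zero hz))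
  have h : Complex.normSq (z ^ 2) < 1 := by
    rw [← Complex.sq_norm]
    exact pow_lt_one₀ (norm_nonneg _) (norm_sq_lt_one hz) two_ne_zero
  rw [Complex.normSq_apply] at h
  simp only [Complex.add_re, Complex.sub_re, Complex.add_im, Complex.sub_im, Complex.one_re,
    Complex.one_im]
  nlinarith

/-- The Taylor coefficients of the extremal function `f₂`. -/
noncomputable def extremalCoeff (β : ℝ) : ℕ → ℂ
  | 0 => 0
  | n + 1 => evenKernelCoeff n / ((β + (1 - β) * ((n : ℝ) + 1) : ℝ) : ℂ)

theorem one_le_transform_multiplier {β : ℝ} (hβ : β ≤ 1) (n : ℕ) :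
    1 ≤ β + (1 - β) * ((n : ℝ) + 1) := by
  nlinarith [mul_nonneg (sub_nonneg.2 hβ) n.cast_nonneg]

theorem norm_extremalCoeff_le {β : ℝ} (hβ : β ≤ 1) (n : ℕ) : ‖extremalCoeff β n‖ ≤ 2 := by
  cases n with
  | zero => simp [extremalCoeff]
  | succ n =>
    have hD := one_le_transform_multiplier hβ n
    rw [extremalCoeff, norm_div, Complex.norm_real, Real.norm_of_nonneg (zero_le_one.trans hD)]
    exact (div_le_self (norm_nonneg _) hD).trans (norm_evenKernelCoeff_le n)

theorem hasSum_extremalCoeff {β : ℝ} (hβ : β ≤ 1) {z : ℂ} (hz : z ∈ ball (0 : ℂ) 1) :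
    HasSum (fun n => extremalCoeff β n * z ^ n) (∑' n, extremalCoeff β n * z ^ n) := by
  have hz1 : ‖z‖ < 1 := by simpa using hz
  refine (Summable.of_norm_bounded
    ((summable_geometric_of_lt_one (norm_nonneg z) hz1).mul_left 2) fun n => ?_).hasSum
  rw [norm_mul, norm_pow]
  gcongr
  exact norm_extremalCoeff_le hβ n

theorem exists_isAbeta_extremal {β : ℝ} (hβ : β ≤ 1) :
    ∃ b g, IsAbeta β b g ∧
      (∀ z ∈ Metric.ball (0 : ℂ) 1, z ≠ 0 →
        (β : ℂ) * g z / z + (1 - (β : ℂ)) * deriv g z = (1 + z ^ 2) / (1 - z ^ 2)) ∧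
      ‖b 3 - (b 2) ^ 2‖ = 2 / (3 - 2 * β) := by
  set g : ℂ → ℂ := fun z => ∑' n, extremalCoeff β n * z ^ n
  have hg : ∀ z ∈ ball (0 : ℂ) 1, HasSum (fun n => extremalCoeff β n * z ^ n) (g z) :=
    fun z hz => hasSum_extremalCoeff hβ hz
  have htrans : ∀ z ∈ ball (0 : ℂ) 1, z ≠ 0 →
      (β : ℂ) * g z / z + (1 - (β : ℂ)) * deriv g z = (1 + z ^ 2) / (1 - z ^ 2) := by
    intro z hz hz0
    refine (hasSum_abeta_transform (β : ℂ) rfl hg hz hz0).unique ?_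
    convert! hasSum_evenKernelCoeff hz using 3 with n
    have hDn : ((β + (1 - β) * ((n : ℝ) + 1) : ℝ) : ℂ) ≠ 0 := by
      exact_mod_cast (zero_lt_one.trans_le (one_le_transform_multiplier hβ n)).ne'
    rw [extremalCoeff, mul_div_assoc', div_eq_iff hDn]
    push_cast
    ring
  refine ⟨extremalCoeff β, g, ⟨rfl, by simp [extremalCoeff, evenKernelCoeff], hg,
    fun z hz hz0 => ?_⟩, htrans, ?_⟩
  · rw [htrans z hz hz0]
    exact re_one_add_sq_div_one_sub_sq_pos hz
  · have h3 : 0 < 3 - 2 * β := by linarith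
    have : extremalCoeff β 3 - extremalCoeff β 2 ^ 2 = ((2 / (3 - 2 * β) : ℝ) : ℂ) := by
      simp [extremalCoeff, evenKernelCoeff]
      ring
    rw [this, Complex.norm_real, Real.norm_of_nonneg (by positivity)]

theorem stmt5 (β : ℝ) (hβ : β ∈ Set.Icc (0 : ℝ) 1)
    (a : ℕ → ℂ) (f : ℂ → ℂ) (hf : IsAbeta β a f) :
    ‖a 3 - (a 2) ^ 2‖ ≤ 2 / (3 - 2 * β) ∧
    -- sharpness: equality for the function `f₂ ∈ 𝒜_β` determined by
    -- `β f₂(z)/z + (1-β) f₂'(z) = (1+z²)/(1-z²)`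
    ∃ b g, IsAbeta β b g ∧
      (∀ z ∈ Metric.ball (0 : ℂ) 1, z ≠ 0 →
        (β : ℂ) * g z / z + (1 - (β : ℂ)) * deriv g z = (1 + z ^ 2) / (1 - z ^ 2)) ∧
      ‖b 3 - (b 2) ^ 2‖ = 2 / (3 - 2 * β) :=
  ⟨hf.norm_hankel_le hβ, exists_isAbeta_extremal hβ.2⟩
end
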